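/- arXiv:2406.07921 — 5 statements merged into one kernel-verified Lean document; each statement's English description precedes it below -/
import Mathlib

section
/- Suppose for each EV v there are two feasible charging profiles (p̂_{v,t}, ê_{v,t}) and (p̌_{v,t}, ě_{v,t}). Define the aggregate boundary trajectories p̂_{d,t} = ∑_{v∈V} p̂_{v,t} and p̌_{d,t} = ∑_{v∈V} p̌_{v,t}, and assume p̌_{d,t} ≤ p̂_{d,t} for every t. Then for any aggregate charging power trajectory (p_{d,t})_{t=1}^T satisfying p̌_{d,t} ≤ p_{d,t} ≤ p̂_{d,t} for all t, there exists for each EV v a feasible charging profile (p_{v,t}, e_{v,t}) such that ∑_{v∈V} p_{v,t} = p_{d,t} for every time slot t. (Proposition 1: any aggregate power trajectory inside the flexibility region is achievable by a feasible disaggregation.) -/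
/-- A feasible charging profile for a single EV with arrival time `ta`, departure time `td`,
maximum charging power `pbar`, initial energy `ea`, required departure energy `ed`,
energy bounds `elo ≤ ehi`, charging efficiency `ηc`, and slot length `Δt`,
over a horizon of `T` time slots. -/
def FeasibleProfile (T ta td : ℕ) (pbar ea ed elo ehi ηc Δt : ℝ)
    (p e : ℕ → ℝ) : Prop :=
  (∀ t, ta ≤ t → t ≤ td → 0 ≤ p t ∧ p t ≤ pbar) ∧
  (∀ t, ¬(ta ≤ t ∧ t ≤ td) → p t = 0) ∧
  (∀ t, 1 ≤ t → t < T → e (t + 1) = e t + ηc * p t * Δt) ∧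
  e ta = ea ∧
  ed ≤ e td ∧
  (∀ t, 1 ≤ t → t ≤ T → elo ≤ e t ∧ e t ≤ ehi)

/-- A map that preserves the unit cube and is monotone on it has a fixed point there. -/
theorem exists_fixedPoint_of_monotone_cube {ι : Type*} (Φ : (ι → ℝ) → ι → ℝ)
    (hmaps : ∀ h : ι → ℝ, (∀ i, h i ∈ Set.Icc (0 : ℝ) 1) → ∀ i, Φ h i ∈ Set.Icc (0 : ℝ) 1)
    (hmono : ∀ h k : ι → ℝ, (∀ i, h i ∈ Set.Icc (0 : ℝ) 1) → (∀ i, k i ∈ Set.Icc (0 : ℝ) 1) →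
      (∀ i, h i ≤ k i) → ∀ i, Φ h i ≤ Φ k i) :
    ∃ h : ι → ℝ, (∀ i, h i ∈ Set.Icc (0 : ℝ) 1) ∧ ∀ i, Φ h i = h i := by
  have : Fact ((0 : ℝ) ≤ 1) := ⟨zero_le_one⟩
  let F : (ι → Set.Icc (0 : ℝ) 1) →o (ι → Set.Icc (0 : ℝ) 1) :=
    { toFun := fun h i => ⟨Φ (fun j => h j) i, hmaps _ (fun j => (h j).2) i⟩
      monotone' := fun h k hk i =>
        hmono _ _ (fun j => (h j).2) (fun j => (k j).2) (fun j => hk j) i }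
  refine ⟨fun i => F.lfp i, fun i => (F.lfp i).2, fun i => ?_⟩
  exact congrArg Subtype.val (congrFun F.map_lfp i)

/-- Scaling the positive and negative parts of `x` by factors in `[0, 1]` gives a number
between `0` and `x`. -/
theorem mul_posPart_sub_mul_negPart_mem_uIcc {a b : ℝ} (ha : a ∈ Set.Icc (0 : ℝ) 1)
    (hb : b ∈ Set.Icc (0 : ℝ) 1) (x : ℝ) : a * x⁺ - b * x⁻ ∈ Set.uIcc 0 x := by
  obtain ⟨ha0, ha1⟩ := ha
  obtain ⟨hb0, hb1⟩ := hb
  rcases le_total 0 x with hx | hx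
  · rw [Set.uIcc_of_le hx, posPart_eq_self.2 hx, negPart_eq_zero.2 hx]
    constructor <;> nlinarith
  · rw [Set.uIcc_of_ge hx, posPart_eq_zero.2 hx, negPart_eq_neg.2 hx]
    constructor <;> nlinarith

/-- Let `E v` be driven by the increments `d v`. Any aggregate `s` between `0` and `∑ v, d v` is
the aggregate of increments `d'` driving some `E'`, where `d'` and `E'` lie entrywise between `0`
and `d`, `E`. Viewing `d` and `E` as a flow on a time-expanded network, the factors multiplying
the flow out of each node are the fractions of its throughput that originate from `s`. -/
theorem exists_conformal_subflow {V : Type*} [Fintype V] (T : ℕ) (d E : V → ℕ → ℝ)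
    (hE : ∀ v t, 1 ≤ t → t < T → E v (t + 1) = E v t + d v t) (s : ℕ → ℝ)
    (hs : ∀ t, 1 ≤ t → t ≤ T → 0 ≤ s t ∧ s t ≤ ∑ v, d v t) :
    ∃ d' E' : V → ℕ → ℝ,
      (∀ v t, d' v t ∈ Set.uIcc 0 (d v t)) ∧ (∀ v t, E' v t ∈ Set.uIcc 0 (E v t)) ∧
      (∀ v t, 1 ≤ t → t < T → E' v (t + 1) = E' v t + d' v t) ∧
      ∀ t, 1 ≤ t → t ≤ T → ∑ v, d' v t = s t := by
  let inflow : (ℕ ⊕ V × ℕ → ℝ) → ℕ ⊕ V × ℕ → ℝ := fun h => Sum.elim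
    (fun t => ∑ v, h (.inr (v, t)) * (d v t)⁻ + s t)
    (fun x => h (.inr (x.1, x.2 - 1)) * (E x.1 x.2)⁺ +
      h (.inr (x.1, x.2 + 1)) * (E x.1 (x.2 + 1))⁻ + h (.inl x.2) * (d x.1 x.2)⁺)
  let thr : ℕ ⊕ V × ℕ → ℝ := Sum.elim (fun t => ∑ v, (d v t)⁺)
    (fun x => (E x.1 (x.2 + 1))⁺ + (E x.1 x.2)⁻ + (d x.1 x.2)⁻)
  let inner : Set (ℕ ⊕ V × ℕ) :=
    {i | Sum.elim (fun t => 1 ≤ t ∧ t ≤ T) (fun x => 1 ≤ x.2 ∧ x.2 < T) i}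
  have split (x : ℝ) : x = x⁺ - x⁻ := (posPart_sub_negPart x).symm
  have inflow_mem : ∀ h : ℕ ⊕ V × ℕ → ℝ, (∀ i, h i ∈ Set.Icc (0 : ℝ) 1) → ∀ i ∈ inner,
      0 ≤ inflow h i ∧ inflow h i ≤ thr i := by
    intro h hh i hi
    have nn (j : ℕ ⊕ V × ℕ) (x : ℝ) (hx : 0 ≤ x) : 0 ≤ h j * x := mul_nonneg (hh j).1 hx
    have le (j : ℕ ⊕ V × ℕ) (x : ℝ) (hx : 0 ≤ x) : h j * x ≤ x :=
      mul_le_of_le_one_left hx (hh j).2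
    rcases i with t | ⟨v, t⟩
    · obtain ⟨h1, h2⟩ := hs t hi.1 hi.2
      refine ⟨add_nonneg (Finset.sum_nonneg fun v _ => nn _ _ (negPart_nonneg _)) h1, ?_⟩
      have hle : ∑ v, h (.inr (v, t)) * (d v t)⁻ ≤ ∑ v, (d v t)⁻ :=
        Finset.sum_le_sum fun v _ => le _ _ (negPart_nonneg _)
      have hsum : ∑ v, d v t = ∑ v, (d v t)⁺ - ∑ v, (d v t)⁻ := by
        rw [← Finset.sum_sub_distrib]
        exact Finset.sum_congr rfl fun v _ => split _
      simp only [inflow, thr, Sum.elim_inl]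
      linarith
    · have h1 := posPart_nonneg (E v t)
      have h2 := negPart_nonneg (E v (t + 1))
      have h3 := posPart_nonneg (d v t)
      refine ⟨add_nonneg (add_nonneg (nn _ _ h1) (nn _ _ h2)) (nn _ _ h3), ?_⟩
      simp only [inflow, thr, Sum.elim_inr]
      linarith [le (.inr (v, t - 1)) _ h1, le (.inr (v, t + 1)) _ h2, le (.inl t) _ h3,
        hE v t hi.1 hi.2, split (E v t), split (E v (t + 1)), split (d v t)]
  classical
  obtain ⟨h, hh, hfix⟩ := exists_fixedPoint_of_monotone_cube
    (fun h i => if i ∈ inner then inflow h i / thr i else 0)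
    (by
      intro h hh i
      split_ifs with hi
      · obtain ⟨h1, h2⟩ := inflow_mem h hh i hi
        exact ⟨div_nonneg h1 (h1.trans h2), div_le_one_of_le₀ h2 (h1.trans h2)⟩
      · exact ⟨le_rfl, zero_le_one⟩)
    (by
      intro h k hh hk hhk i
      split_ifs with hi
      · obtain ⟨h1, h2⟩ := inflow_mem h hh i hi
        refine div_le_div_of_nonneg_right ?_ (h1.trans h2)
        have le (j : ℕ ⊕ V × ℕ) (x : ℝ) (hx : 0 ≤ x) : h j * x ≤ k j * x :=
          mul_le_mul_of_nonneg_right (hhk j) hx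
        rcases i with t | ⟨v, t⟩
        · exact add_le_add_left (Finset.sum_le_sum fun v _ => le _ _ (negPart_nonneg _)) _
        · exact add_le_add (add_le_add (le _ _ (posPart_nonneg _)) (le _ _ (negPart_nonneg _)))
            (le _ _ (posPart_nonneg _))
      · exact le_rfl)
  have balance : ∀ i ∈ inner, h i * thr i = inflow h i := by
    intro i hi
    obtain ⟨h1, h2⟩ := inflow_mem h hh i hi
    have hi' := hfix i
    rw [if_pos hi] at hi'
    rw [← hi']
    exact div_mul_cancel_of_imp fun h0 => le_antisymm (h0 ▸ h2) h1
  refine ⟨fun v t => h (.inl t) * (d v t)⁺ - h (.inr (v, t)) * (d v t)⁻,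
    fun v t => h (.inr (v, t - 1)) * (E v t)⁺ - h (.inr (v, t)) * (E v t)⁻,
    fun v t => mul_posPart_sub_mul_negPart_mem_uIcc (hh _) (hh _) _,
    fun v t => mul_posPart_sub_mul_negPart_mem_uIcc (hh _) (hh _) _, ?_, ?_⟩
  · intro v t h1 h2
    have hb := balance (.inr (v, t)) ⟨h1, h2⟩
    simp only [inflow, thr, Sum.elim_inr] at hb
    simp only [Nat.add_sub_cancel]
    linarith
  · intro t h1 h2
    have hb := balance (.inl t) ⟨h1, h2⟩
    simp only [inflow, thr, Sum.elim_inl] at hb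
    rw [Finset.sum_sub_distrib, ← Finset.mul_sum]
    linarith

/-- Moving from `a` by a step between `0` and `b - a` stays in any interval containing
`a` and `b`. -/
theorem add_mem_Icc_of_mem_uIcc {a b x l u : ℝ} (ha : l ≤ a ∧ a ≤ u) (hb : l ≤ b ∧ b ≤ u)
    (hx : x ∈ Set.uIcc 0 (b - a)) : l ≤ a + x ∧ a + x ≤ u := by
  rcases Set.mem_uIcc.1 hx with h | h <;> constructor <;> linarith [h.1, h.2, ha.1, ha.2, hb.1, hb.2]

/-- Proposition 1: any aggregate charging power trajectory lying between the lower and upper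
boundary trajectories of the aggregate EV power flexibility region can be disaggregated into
feasible charging profiles of the individual EVs. -/
theorem aggregate_flexibility_disaggregation
    {V : Type*} [Fintype V] (T : ℕ)
    (ta td : V → ℕ) (pbar ea ed elo ehi : V → ℝ) (ηc Δt : ℝ)
    (hηc : 0 < ηc) (hΔt : 0 < Δt)
    (hta : ∀ v, 1 ≤ ta v) (htatd : ∀ v, ta v ≤ td v) (htdT : ∀ v, td v ≤ T)
    (hpbar : ∀ v, 0 ≤ pbar v) (helohi : ∀ v, elo v ≤ ehi v)
    (phat ehat pchk echk : V → ℕ → ℝ)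
    (hhat : ∀ v, FeasibleProfile T (ta v) (td v) (pbar v) (ea v) (ed v) (elo v) (ehi v)
      ηc Δt (phat v) (ehat v))
    (hchk : ∀ v, FeasibleProfile T (ta v) (td v) (pbar v) (ea v) (ed v) (elo v) (ehi v)
      ηc Δt (pchk v) (echk v))
    (pdhat pdchk : ℕ → ℝ)
    (hpdhat : ∀ t, pdhat t = ∑ v, phat v t)
    (hpdchk : ∀ t, pdchk t = ∑ v, pchk v t)
    (hbnd : ∀ t, 1 ≤ t → t ≤ T → pdchk t ≤ pdhat t)
    (pd : ℕ → ℝ)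
    (hpd : ∀ t, 1 ≤ t → t ≤ T → pdchk t ≤ pd t ∧ pd t ≤ pdhat t) :
    ∃ p e : V → ℕ → ℝ,
      (∀ v, FeasibleProfile T (ta v) (td v) (pbar v) (ea v) (ed v) (elo v) (ehi v)
        ηc Δt (p v) (e v)) ∧
      (∀ t, 1 ≤ t → t ≤ T → ∑ v, p v t = pd t) := by
  have hc : 0 < ηc * Δt := mul_pos hηc hΔt
  obtain ⟨d, E, hd, hE, hdyn, hsum⟩ := exists_conformal_subflow T
    (fun v t => phat v t - pchk v t) (fun v t => (ehat v t - echk v t) / (ηc * Δt))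
    (by
      intro v t h1 h2
      have e1 := (hhat v).2.2.1 t h1 h2
      have e2 := (hchk v).2.2.1 t h1 h2
      simp only [e1, e2]
      field_simp
      ring)
    (fun t => pd t - pdchk t)
    (by
      intro t h1 h2
      obtain ⟨h3, h4⟩ := hpd t h1 h2
      rw [Finset.sum_sub_distrib, ← hpdhat, ← hpdchk]
      constructor <;> linarith)
  have hE' : ∀ v t, ηc * Δt * E v t ∈ Set.uIcc 0 (ehat v t - echk v t) := by
    intro v t
    have hmem : ηc * Δt * E v t ∈
        (fun y => ηc * Δt * y) '' Set.uIcc 0 ((ehat v t - echk v t) / (ηc * Δt)) :=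
      ⟨_, hE v t, rfl⟩
    rwa [Set.image_const_mul_uIcc, mul_zero, mul_div_cancel₀ _ hc.ne'] at hmem
  refine ⟨fun v t => pchk v t + d v t, fun v t => echk v t + ηc * Δt * E v t, fun v => ?_, ?_⟩
  · obtain ⟨p1, p2, p3, p4, p5, p6⟩ := hhat v
    obtain ⟨q1, q2, q3, q4, q5, q6⟩ := hchk v
    refine ⟨fun t h1 h2 => add_mem_Icc_of_mem_uIcc (q1 t h1 h2) (p1 t h1 h2) (hd v t),
      fun t ht => ?_, fun t h1 h2 => ?_, ?_, ?_, fun t h1 h2 =>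
        add_mem_Icc_of_mem_uIcc (q6 t h1 h2) (p6 t h1 h2) (hE' v t)⟩
    · have := add_mem_Icc_of_mem_uIcc ⟨(q2 t ht).ge, (q2 t ht).le⟩ ⟨(p2 t ht).ge, (p2 t ht).le⟩
        (hd v t)
      exact le_antisymm this.2 this.1
    · simp only [hdyn v t h1 h2, q3 t h1 h2]
      ring
    · have := add_mem_Icc_of_mem_uIcc ⟨q4.ge, q4.le⟩ ⟨p4.ge, p4.le⟩ (hE' v (ta v))
      exact le_antisymm this.2 this.1
    · exact (add_mem_Icc_of_mem_uIcc ⟨q5, le_max_left _ (ehat v (td v))⟩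
        ⟨p5, le_max_right _ _⟩ (hE' v (td v))).1
  · intro t h1 h2
    rw [Finset.sum_add_distrib, hsum t h1 h2, ← hpdchk]
    ring
end

section
/- Fix a slot t with data ρ_t > 0, electricity price 0 ≤ π^e_t ≤ π^{e,max}, carbon price π^c_t ≥ 0, weight V2 ≥ 0, slot length Δt > 0, and current footprint c_t with 0 ≤ c_t < m^{b,max}. Set φ_t = m^{b,max} + V2·π^{e,max}/ρ_t and H_t = c_t − φ_t. Then the function J(p, m) = H_t·(ρ_t p Δt − m) + V2·(π^e_t p Δt + π^c_t m) is strictly decreasing in p and strictly increasing in m on [0, p^{g,max}] × [0, m^{b,max}]; hence its unique minimizer over that box is (p, m) = (p^{g,max}, 0). Moreover, if ρ_t p^{g,max} Δt + m^{b,max} ≤ c^{max}, then the updated footprint c_{t+1} = c_t + ρ_t p^{g,max} Δt satisfies 0 ≤ c_{t+1} ≤ c^{max}. -/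
/-- Case 1 of Proposition 3: when the current carbon footprint satisfies
`0 ≤ c_t < m^{b,max}`, the per-slot online objective
`J(p,m) = H_t (ρ_t p Δt − m) + V2 (π^e_t p Δt + π^c_t m)` with
`H_t = c_t − φ_t` and `φ_t = m^{b,max} + V2 π^{e,max}/ρ_t`
is strictly decreasing in `p` and strictly increasing in `m` on
`[0, p^{g,max}] × [0, m^{b,max}]`, so its unique minimizer is `(p^{g,max}, 0)`;
moreover the updated footprint `c_{t+1} = c_t + ρ_t p^{g,max} Δt` stays in `[0, c^{max}]`
provided `ρ_t p^{g,max} Δt + m^{b,max} ≤ c^{max}`. -/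
theorem online_carbon_case1
    (ρ πe πemax πc V2 Δt ct mbmax pgmax cmax φ H : ℝ)
    (hρ : 0 < ρ) (hπe0 : 0 ≤ πe) (hπe : πe ≤ πemax) (hπc : 0 ≤ πc)
    (hV2 : 0 ≤ V2) (hΔt : 0 < Δt)
    (hct0 : 0 ≤ ct) (hct : ct < mbmax) (hpg : 0 ≤ pgmax)
    (hφ : φ = mbmax + V2 * πemax / ρ) (hH : H = ct - φ)
    (J : ℝ → ℝ → ℝ)
    (hJ : ∀ p m, J p m = H * (ρ * p * Δt - m) + V2 * (πe * p * Δt + πc * m)) :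
    (∀ p₁ p₂ m, 0 ≤ p₁ → p₂ ≤ pgmax → p₁ < p₂ → 0 ≤ m → m ≤ mbmax →
      J p₂ m < J p₁ m) ∧
    (∀ p m₁ m₂, 0 ≤ p → p ≤ pgmax → 0 ≤ m₁ → m₂ ≤ mbmax → m₁ < m₂ →
      J p m₁ < J p m₂) ∧
    (∀ p m, 0 ≤ p → p ≤ pgmax → 0 ≤ m → m ≤ mbmax → (p, m) ≠ (pgmax, 0) →
      J pgmax 0 < J p m) ∧
    (ρ * pgmax * Δt + mbmax ≤ cmax →
      0 ≤ ct + ρ * pgmax * Δt ∧ ct + ρ * pgmax * Δt ≤ cmax) := by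
  have hq : 0 ≤ V2 * πemax / ρ := by
    have : 0 ≤ πemax := hπe0.trans hπe
    positivity
  have hHρ : H * ρ = (ct - mbmax) * ρ - V2 * πemax := by
    rw [hH, hφ]
    field_simp
    ring
  have hslope_p : (H * ρ + V2 * πe) * Δt < 0 := by
    refine mul_neg_of_neg_of_pos ?_ hΔt
    have h₁ : (ct - mbmax) * ρ < 0 := mul_neg_of_neg_of_pos (sub_neg.2 hct) hρ
    have h₂ : V2 * πe ≤ V2 * πemax := mul_le_mul_of_nonneg_left hπe hV2
    linarith
  have hslope_m : 0 < V2 * πc - H := by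
    have : 0 ≤ V2 * πc := mul_nonneg hV2 hπc
    linarith
  have hJ' : ∀ p m, J p m = (H * ρ + V2 * πe) * Δt * p + (V2 * πc - H) * m := by
    intro p m
    rw [hJ]
    ring
  have anti : ∀ m, StrictAnti fun p => J p m := by
    intro m p₁ p₂ h
    have := mul_lt_mul_of_neg_left h hslope_p
    simp only [hJ']
    linarith
  have mono : ∀ p, StrictMono (J p) := by
    intro p m₁ m₂ h
    have := mul_lt_mul_of_pos_left h hslope_m
    simp only [hJ']
    linarith
  refine ⟨fun _ _ m _ _ h _ _ => anti m h, fun p _ _ _ _ _ _ h => mono p h, ?_, ?_⟩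
  · intro p m _ hp hm _ hne
    rcases hp.lt_or_eq with hp | rfl
    · exact (anti 0 hp).trans_le ((mono p).monotone hm)
    · exact mono p (hm.lt_of_ne fun h => hne (by rw [h]))
  · intro hcap
    exact ⟨by positivity, by linarith⟩
end

section
/- Fix a slot t with carbon intensity 0 ≤ ρ_t ≤ ρ^{max}, where ρ^{min} > 0 is a lower bound on carbon intensities, and suppose π^{c,max} + π^{e,max}/ρ^{min} > 0. Assume the weight satisfies 0 ≤ V2 ≤ (c^{max} − m^{b,max} − ρ^{max} p^{g,max} Δt)/(π^{c,max} + π^{e,max}/ρ^{min}), and the current footprint satisfies m^{b,max} ≤ c_t ≤ V2·(π^{c,max} + π^{e,max}/ρ^{min}) + m^{b,max}. Then for ANY feasible decisions 0 ≤ p ≤ p^{g,max} and 0 ≤ m ≤ m^{b,max}, the updated footprint c_{t+1} = c_t + ρ_t p Δt − m satisfies 0 ≤ c_{t+1} ≤ c^{max}. -/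
/-- Case 2 of Proposition 3: if the weight satisfies
`0 ≤ V2 ≤ (c^{max} − m^{b,max} − ρ^{max} p^{g,max} Δt)/(π^{c,max} + π^{e,max}/ρ^{min})`
and the current footprint satisfies
`m^{b,max} ≤ c_t ≤ V2 (π^{c,max} + π^{e,max}/ρ^{min}) + m^{b,max}`,
then for ANY feasible decisions `0 ≤ p ≤ p^{g,max}` and `0 ≤ m ≤ m^{b,max}`,
the updated footprint `c_{t+1} = c_t + ρ_t p Δt − m` stays in `[0, c^{max}]`. -/
theorem online_carbon_case2
    (ρt ρmin ρmax πemax πcmax V2 Δt ct mbmax pgmax cmax p m : ℝ)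
    (hρ0 : 0 ≤ ρt) (hρ : ρt ≤ ρmax) (hρmin : 0 < ρmin)
    (hden : 0 < πcmax + πemax / ρmin)
    (hΔt : 0 < Δt)
    (hV20 : 0 ≤ V2)
    (hV2 : V2 ≤ (cmax - mbmax - ρmax * pgmax * Δt) / (πcmax + πemax / ρmin))
    (hct1 : mbmax ≤ ct) (hct2 : ct ≤ V2 * (πcmax + πemax / ρmin) + mbmax)
    (hp0 : 0 ≤ p) (hp : p ≤ pgmax) (hm0 : 0 ≤ m) (hm : m ≤ mbmax) :
    0 ≤ ct + ρt * p * Δt - m ∧ ct + ρt * p * Δt - m ≤ cmax := by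
  have hV := (le_div_iff₀ hden).mp hV2
  have hlow : 0 ≤ ρt * p * Δt := by positivity
  have hupp : ρt * p * Δt ≤ ρmax * pgmax * Δt :=
    mul_le_mul_of_nonneg_right (mul_le_mul hρ hp hp0 (hρ0.trans hρ)) hΔt.le
  constructor <;> linarith
end

section
/- Fix a slot t with data ρ^{min} ≤ ρ_t ≤ ρ^{max} where ρ^{min} > 0, electricity price 0 ≤ π^e_t ≤ π^{e,max}, carbon price 0 ≤ π^c_t ≤ π^{c,max}, weight V2 ≥ 0, slot length Δt > 0, and current footprint c_t with V2·(π^{c,max} + π^{e,max}/ρ^{min}) + m^{b,max} < c_t ≤ c^{max}. Set φ_t = m^{b,max} + V2·π^{e,max}/ρ_t and H_t = c_t − φ_t. Then the function J(p, m) = H_t·(ρ_t p Δt − m) + V2·(π^e_t p Δt + π^c_t m) is strictly increasing in p and strictly decreasing in m on [0, p^{g,max}] × [0, m^{b,max}]; hence its unique minimizer over that box is (p, m) = (0, m^{b,max}). Moreover, the updated footprint c_{t+1} = c_t − m^{b,max} satisfies 0 ≤ c_{t+1} ≤ c^{max}. -/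
/-- Case 3 of Proposition 3: when the current carbon footprint satisfies
`V2 (π^{c,max} + π^{e,max}/ρ^{min}) + m^{b,max} < c_t ≤ c^{max}`, the per-slot online
objective `J(p,m) = H_t (ρ_t p Δt − m) + V2 (π^e_t p Δt + π^c_t m)` with
`H_t = c_t − φ_t` and `φ_t = m^{b,max} + V2 π^{e,max}/ρ_t`
is strictly increasing in `p` and strictly decreasing in `m` on
`[0, p^{g,max}] × [0, m^{b,max}]`, so its unique minimizer is `(0, m^{b,max})`;
moreover the updated footprint `c_{t+1} = c_t − m^{b,max}` stays in `[0, c^{max}]`. -/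
theorem online_carbon_case3
    (ρ ρmin ρmax πe πemax πc πcmax V2 Δt ct mbmax pgmax cmax φ H : ℝ)
    (hρmin : 0 < ρmin) (hρ1 : ρmin ≤ ρ) (hρ2 : ρ ≤ ρmax)
    (hπe0 : 0 ≤ πe) (hπe : πe ≤ πemax)
    (hπc0 : 0 ≤ πc) (hπc : πc ≤ πcmax)
    (hV2 : 0 ≤ V2) (hΔt : 0 < Δt)
    (hmb : 0 ≤ mbmax) (hpg : 0 ≤ pgmax)
    (hct1 : V2 * (πcmax + πemax / ρmin) + mbmax < ct) (hct2 : ct ≤ cmax)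
    (hφ : φ = mbmax + V2 * πemax / ρ) (hH : H = ct - φ)
    (J : ℝ → ℝ → ℝ)
    (hJ : ∀ p m, J p m = H * (ρ * p * Δt - m) + V2 * (πe * p * Δt + πc * m)) :
    (∀ p₁ p₂ m, 0 ≤ p₁ → p₂ ≤ pgmax → p₁ < p₂ → 0 ≤ m → m ≤ mbmax →
      J p₁ m < J p₂ m) ∧
    (∀ p m₁ m₂, 0 ≤ p → p ≤ pgmax → 0 ≤ m₁ → m₂ ≤ mbmax → m₁ < m₂ →
      J p m₂ < J p m₁) ∧
    (∀ p m, 0 ≤ p → p ≤ pgmax → 0 ≤ m → m ≤ mbmax → (p, m) ≠ (0, mbmax) →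
      J 0 mbmax < J p m) ∧
    (0 ≤ ct - mbmax ∧ ct - mbmax ≤ cmax) := by
  have hρ : 0 < ρ := hρmin.trans_le hρ1
  have hπemax : 0 ≤ πemax := hπe0.trans hπe
  have hdiv : V2 * πemax / ρ ≤ V2 * (πemax / ρmin) := by
    rw [mul_div_assoc]
    gcongr
  have hcarbon : V2 * πc ≤ V2 * πcmax := by gcongr
  have hHlb : V2 * πc < H := by
    rw [hH, hφ]
    linarith
  have hVπc : 0 ≤ V2 * πc := mul_nonneg hV2 hπc0
  have hslope_p : 0 < (H * ρ + V2 * πe) * Δt := by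
    have hHpos : 0 < H := hVπc.trans_lt hHlb
    positivity
  have hslope_m : 0 < H - V2 * πc := sub_pos.mpr hHlb
  have hJ_eq : ∀ p m, J p m = (H * ρ + V2 * πe) * Δt * p - (H - V2 * πc) * m := by
    intro p m
    rw [hJ]
    ring
  have hmono : ∀ p₁ p₂ m, p₁ < p₂ → J p₁ m < J p₂ m := by
    intro p₁ p₂ m h
    simp only [hJ_eq]
    gcongr
  have hanti : ∀ p m₁ m₂, m₁ < m₂ → J p m₂ < J p m₁ := by
    intro p m₁ m₂ h
    simp only [hJ_eq]
    gcongr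
  refine ⟨fun p₁ p₂ m _ _ h _ _ => hmono p₁ p₂ m h,
    fun p m₁ m₂ _ _ _ _ h => hanti p m₁ m₂ h, ?_, ?_, by linarith⟩
  · intro p m hp _ _ hm hne
    rcases hp.eq_or_lt with rfl | hp
    · exact hanti _ _ _ (hm.lt_of_ne fun h => hne (by rw [h]))
    · rcases hm.eq_or_lt with rfl | hm
      · exact hmono _ _ _ hp
      · exact (hanti _ _ _ hm).trans (hmono _ _ _ hp)
  · have hVe : 0 ≤ V2 * (πemax / ρmin) := by positivity
    linarith
end

section
/- (Proposition 3.) Suppose the per-slot data satisfy ρ^{min} ≤ ρ_t ≤ ρ^{max} with ρ^{min} > 0, 0 ≤ π^e_t ≤ π^{e,max}, and 0 ≤ π^c_t ≤ π^{c,max} for all t, with π^{c,max} + π^{e,max}/ρ^{min} > 0, and assume ρ^{max} p^{g,max} Δt + m^{b,max} ≤ c^{max} and 0 ≤ V2 ≤ (c^{max} − m^{b,max} − ρ^{max} p^{g,max} Δt)/(π^{c,max} + π^{e,max}/ρ^{min}). For each t, set φ_t = m^{b,max} + V2·π^{e,max}/ρ_t, H_t = c_t − φ_t, and let (p_t, m_t)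 be any minimizer of J_t(p, m) = H_t·(ρ_t p Δt − m) + V2·(π^e_t p Δt + π^c_t m) over the feasible set, which is [0, p^{g,max}] × [0, m^{b,max}] if t ∈ 𝒯_C (a carbon-trading slot) and [0, p^{g,max}] × {0} otherwise; update c_{t+1} = c_t + ρ_t p_t Δt − m_t. If 0 ≤ c_1 ≤ c^{max}, then 0 ≤ c_t ≤ c^{max} for every t, i.e., the online solutions of P2' always satisfy the carbon emission quota constraint even though it is not imposed explicitly. -/
/-- Proposition 3: under the stated bounds on the per-slot data, the choice of the
perturbation parameter `φ_t = m^{b,max} + V2 π^{e,max}/ρ_t` and the weight bound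
`0 ≤ V2 ≤ (c^{max} − m^{b,max} − ρ^{max} p^{g,max} Δt)/(π^{c,max} + π^{e,max}/ρ^{min})`,
any sequence of per-slot minimizers `(p_t, m_t)` of the online objective
`J_t(p,m) = H_t (ρ_t p Δt − m) + V2 (π^e_t p Δt + π^c_t m)` (with `H_t = c_t − φ_t`,
`m` restricted to `0` outside carbon-trading slots `𝒯_C`) keeps the carbon footprint
`c_{t+1} = c_t + ρ_t p_t Δt − m_t` within the quota: `0 ≤ c_t ≤ c^{max}` for all `t ≥ 1`. -/
theorem online_carbon_quota_feasibility
    (ρ πe πc p m c : ℕ → ℝ) (TC : Set ℕ)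
    (ρmin ρmax πemax πcmax V2 Δt mbmax pgmax cmax : ℝ)
    (hρmin : 0 < ρmin) (hρ : ∀ t, ρmin ≤ ρ t ∧ ρ t ≤ ρmax)
    (hπe : ∀ t, 0 ≤ πe t ∧ πe t ≤ πemax)
    (hπc : ∀ t, 0 ≤ πc t ∧ πc t ≤ πcmax)
    (hden : 0 < πcmax + πemax / ρmin)
    (hΔt : 0 < Δt) (hmb : 0 ≤ mbmax) (hpg : 0 ≤ pgmax)
    (hcap : ρmax * pgmax * Δt + mbmax ≤ cmax)
    (hV20 : 0 ≤ V2)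
    (hV2 : V2 ≤ (cmax - mbmax - ρmax * pgmax * Δt) / (πcmax + πemax / ρmin))
    (hdyn : ∀ t, c (t + 1) = c t + ρ t * p t * Δt - m t)
    (hpfeas : ∀ t, 0 ≤ p t ∧ p t ≤ pgmax)
    (hmfeas : ∀ t, t ∈ TC → 0 ≤ m t ∧ m t ≤ mbmax)
    (hmzero : ∀ t, t ∉ TC → m t = 0)
    (hopt : ∀ t, ∀ p' m', 0 ≤ p' → p' ≤ pgmax →
      ((t ∈ TC ∧ 0 ≤ m' ∧ m' ≤ mbmax) ∨ (t ∉ TC ∧ m' = 0)) →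
      (c t - (mbmax + V2 * πemax / ρ t)) * (ρ t * p t * Δt - m t)
          + V2 * (πe t * p t * Δt + πc t * m t)
        ≤ (c t - (mbmax + V2 * πemax / ρ t)) * (ρ t * p' * Δt - m')
          + V2 * (πe t * p' * Δt + πc t * m'))
    (hc1 : 0 ≤ c 1 ∧ c 1 ≤ cmax) :
    ∀ t, 1 ≤ t → 0 ≤ c t ∧ c t ≤ cmax := by
  have hπe0 : 0 ≤ πemax := (hπe 0).1.trans (hπe 0).2
  have hπc0 : 0 ≤ πcmax := (hπc 0).1.trans (hπc 0).2
  rw [le_div_iff₀ hden] at hV2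
  intro t ht
  induction t, ht using Nat.le_induction with
  | base => exact hc1
  | succ t _ ih =>
    obtain ⟨hc0, hcmax⟩ := ih
    obtain ⟨hp0, hpmax⟩ := hpfeas t
    have hρt : 0 < ρ t := hρmin.trans_le (hρ t).1
    have hshift0 : 0 ≤ V2 * πemax / ρ t := by positivity
    have hshift : V2 * πemax / ρ t ≤ V2 * (πemax / ρmin) := by
      rw [mul_div_assoc]
      gcongr
      exact (hρ t).1
    have hm : 0 ≤ m t ∧ m t ≤ mbmax := by
      by_cases hT : t ∈ TC
      · exact hmfeas t hT
      · rw [hmzero t hT]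
        exact ⟨le_rfl, hmb⟩
    have hinflow0 : 0 ≤ ρ t * p t * Δt := by positivity
    have hinflow : ρ t * p t * Δt ≤ ρmax * pgmax * Δt := by
      have hρmax : 0 ≤ ρmax := hρt.le.trans (hρ t).2
      gcongr
      exact (hρ t).2
    have hbuy : c t < mbmax → m t = 0 := by
      intro hlt
      by_cases hT : t ∈ TC
      · have hJ := hopt t (p t) 0 hp0 hpmax (.inl ⟨hT, le_rfl, hmb⟩)
        by_contra hne
        have hmpos : 0 < m t := lt_of_le_of_ne hm.1 (Ne.symm hne)
        have hH : 0 < mbmax + V2 * πemax / ρ t - c t := by linarith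
        have hgain := mul_pos hH hmpos
        have hcost : 0 ≤ V2 * (πc t * m t) := mul_nonneg hV20 (mul_nonneg (hπc t).1 hm.1)
        linarith
      · exact hmzero t hT
    have hidle : mbmax + V2 * πemax / ρ t < c t → p t = 0 := by
      intro hlt
      have hfeas : (t ∈ TC ∧ 0 ≤ m t ∧ m t ≤ mbmax) ∨ (t ∉ TC ∧ m t = 0) := by
        by_cases hT : t ∈ TC
        · exact .inl ⟨hT, hm⟩
        · exact .inr ⟨hT, hmzero t hT⟩
      have hJ := hopt t 0 (m t) le_rfl hpg hfeas
      by_contra hne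
      have hppos : 0 < p t := lt_of_le_of_ne hp0 (Ne.symm hne)
      have hgain := mul_pos (sub_pos.2 hlt) (mul_pos (mul_pos hρt hppos) hΔt)
      have hcost : 0 ≤ V2 * (πe t * p t * Δt) :=
        mul_nonneg hV20 (mul_nonneg (mul_nonneg (hπe t).1 hp0) hΔt.le)
      linarith
    rw [hdyn t]
    constructor
    · rcases lt_or_ge (c t) mbmax with hlt | hge
      · linarith [hbuy hlt]
      · linarith [hm.2]
    · rcases lt_or_ge (mbmax + V2 * πemax / ρ t) (c t) with hlt | hge
      · rw [hidle hlt]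
        linarith [hm.1]
      · linarith [hm.1, mul_nonneg hV20 hπc0]
end
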